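/- Let Ω ⊂ ℂ be open, let Φ : Ω → ℂ be holomorphic with derivative Φ_z nonvanishing on Ω, and let S, T : ℝ → ℝ be continuously differentiable nonvanishing real-valued functions. Write s = Re Φ and t = Im Φ, define F = S(s)·T(t) and G = i/(S(s)·T(t)), and for each integer m define F_m = (Φ_z)^m·F and G_m = (Φ_z)^m·G when m is even, and F_m = (Φ_z)^m·F / S(s)² and G_m = (Φ_z)^m·S(s)²·G when m is odd. Then for every integer m: Im(conj(F_m)·G_m) > 0 on Ω, and (F_{m+1}, G_{m+1}) is a successor of (F_m, G_m), i.e. a_{(F_{m+1},G_{m+1})} = a_{(F_m,G_m)} and b_{(F_{m+1},G_{m+1})} = −B_{(F_m,G_m)} on Ω. -/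

import Mathlib

open Complex

/-- Partial derivative in `x` of a complex-valued function on `ℂ ≅ ℝ²`. -/
noncomputable def cdx (f : ℂ → ℂ) (z : ℂ) : ℂ := fderiv ℝ f z 1

/-- Partial derivative in `y` of a complex-valued function on `ℂ ≅ ℝ²`. -/
noncomputable def cdy (f : ℂ → ℂ) (z : ℂ) : ℂ := fderiv ℝ f z Complex.I

/-- The Wirtinger derivative `∂_z̄ = ½(∂_x + i∂_y)`. -/
noncomputable def cdzbar (f : ℂ → ℂ) (z : ℂ) : ℂ :=
  (1 / 2 : ℂ) * (cdx f z + Complex.I * cdy f z)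

/-- The Wirtinger derivative `∂_z = ½(∂_x − i∂_y)`. -/
noncomputable def cdz (f : ℂ → ℂ) (z : ℂ) : ℂ :=
  (1 / 2 : ℂ) * (cdx f z - Complex.I * cdy f z)

/-- Characteristic coefficient `a_{(F,G)}`. -/
noncomputable def charA (F G : ℂ → ℂ) (z : ℂ) : ℂ :=
  -((starRingEnd ℂ) (F z) * cdzbar G z - cdzbar F z * (starRingEnd ℂ) (G z)) /
    (F z * (starRingEnd ℂ) (G z) - (starRingEnd ℂ) (F z) * G z)

/-- Characteristic coefficient `b_{(F,G)}`. -/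
noncomputable def charB (F G : ℂ → ℂ) (z : ℂ) : ℂ :=
  (F z * cdzbar G z - cdzbar F z * G z) /
    (F z * (starRingEnd ℂ) (G z) - (starRingEnd ℂ) (F z) * G z)

/-- Characteristic coefficient `B_{(F,G)}`. -/
noncomputable def charBigB (F G : ℂ → ℂ) (z : ℂ) : ℂ :=
  (F z * cdz G z - cdz F z * G z) /
    (F z * (starRingEnd ℂ) (G z) - (starRingEnd ℂ) (F z) * G z)

/-- If `u` is real-valued and `p` is holomorphic, the pair `(p u, i p / u)` has
vanishing `a`, and `b`, `B` are given by the logarithmic Wirtinger derivatives of `u`. -/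
theorem charCoeffs_mul_real {p : ℂ → ℂ} {p' : ℂ} {u : ℂ → ℝ} {L : ℂ →L[ℝ] ℝ} {z : ℂ}
    (hp : HasDerivAt p p' z) (hu : HasFDerivAt u L z) (hp0 : p z ≠ 0) (hu0 : u z ≠ 0)
    {F G : ℂ → ℂ} (hF : ∀ w, F w = p w * (u w : ℂ)) (hG : ∀ w, G w = p w * (I / (u w : ℂ))) :
    0 < ((starRingEnd ℂ) (F z) * G z).im ∧ charA F G z = 0 ∧
    charB F G z = p z / (starRingEnd ℂ) (p z) * ((L 1 + I * L I) / (2 * u z)) ∧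
    charBigB F G z = p z / (starRingEnd ℂ) (p z) * ((L 1 - I * L I) / (2 * u z)) := by
  have hu0' : (u z : ℂ) ≠ 0 := ofReal_ne_zero.2 hu0
  have hpc : (starRingEnd ℂ) (p z) ≠ 0 := (map_ne_zero _).2 hp0
  have hpR := hp.hasFDerivAt.restrictScalars ℝ
  have huC : HasFDerivAt (fun w => (u w : ℂ)) (ofRealCLM.comp L) z :=
    ofRealCLM.hasFDerivAt.comp z hu
  have huI : HasFDerivAt (fun w => ((u w)⁻¹ : ℂ)) (-(((u z : ℂ) ^ 2)⁻¹ • ofRealCLM.comp L)) z := by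
    have h := ((hasDerivAt_inv hu0').hasFDerivAt.restrictScalars ℝ).comp z huC
    refine h.congr_fderiv ?_
    ext w
    simp [mul_comm]
  have hFd : ∀ w, fderiv ℝ F z w = p z * L w + u z * (w * p') := by
    intro w
    rw [funext hF, (hpR.fun_mul huC).fderiv]
    simp
  have hGd : ∀ w, fderiv ℝ G z w = I * (-(p z * L w / (u z) ^ 2) + (w * p') / u z) := by
    intro w
    have : G = fun w => I * (p w * ((u w)⁻¹ : ℂ)) := by
      funext w; rw [hG]; ring
    rw [this, ((hpR.fun_mul huI).const_mul I).fderiv]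
    simp
    ring
  have hden : F z * (starRingEnd ℂ) (G z) - (starRingEnd ℂ) (F z) * G z
      = -2 * I * (p z * (starRingEnd ℂ) (p z)) := by
    rw [hF, hG]
    simp only [map_mul, map_div₀, conj_I, conj_ofReal]
    field_simp
    ring
  refine ⟨?_, ?_, ?_, ?_⟩
  · have : (starRingEnd ℂ) (F z) * G z = ((normSq (p z) : ℝ) : ℂ) * I := by
      rw [hF, hG, normSq_eq_conj_mul_self]
      simp only [map_mul, conj_ofReal]
      field_simp
    rw [this, im_ofReal_mul, I_im, mul_one]
    exact normSq_pos.2 hp0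
  · rw [charA, hden, cdzbar, cdzbar, cdx, cdx, cdy, cdy, hFd, hFd, hGd, hGd, hF, hG]
    simp only [map_mul, map_div₀, conj_I, conj_ofReal]
    refine div_eq_zero_iff.2 (Or.inl ?_)
    field_simp
    ring_nf
    simp only [I_pow_three]
    ring
  · rw [charB, hden, cdzbar, cdzbar, cdx, cdx, cdy, cdy, hFd, hFd, hGd, hGd, hF, hG]
    field_simp
    ring
  · rw [charBigB, hden, cdz, cdz, cdx, cdx, cdy, cdy, hFd, hFd, hGd, hGd, hF, hG]
    field_simp
    ring

/-- Characteristic coefficients of `(p u, i p / u)` for `u = R(Re Φ) T(Im Φ)`. -/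
theorem charCoeffs_mul_separated {p Φ : ℂ → ℂ} {p' P z : ℂ} {R T : ℝ → ℝ} {R' T' : ℝ}
    (hp : HasDerivAt p p' z) (hΦ : HasDerivAt Φ P z)
    (hR : HasDerivAt R R' (Φ z).re) (hT : HasDerivAt T T' (Φ z).im)
    (hp0 : p z ≠ 0) (hR0 : R (Φ z).re ≠ 0) (hT0 : T (Φ z).im ≠ 0)
    {F G : ℂ → ℂ} (hF : ∀ w, F w = p w * (R (Φ w).re * T (Φ w).im : ℂ))
    (hG : ∀ w, G w = p w * (I / (R (Φ w).re * T (Φ w).im : ℂ))) :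
    0 < ((starRingEnd ℂ) (F z) * G z).im ∧ charA F G z = 0 ∧
    charB F G z = p z / (starRingEnd ℂ) (p z) *
      ((starRingEnd ℂ) P / 2 * (R' / R (Φ z).re + I * (T' / T (Φ z).im))) ∧
    charBigB F G z = p z / (starRingEnd ℂ) (p z) *
      (P / 2 * (R' / R (Φ z).re - I * (T' / T (Φ z).im))) := by
  have hΦR := hΦ.hasFDerivAt.restrictScalars ℝ
  have hre := hR.comp_hasFDerivAt z (reCLM.hasFDerivAt.comp z hΦR)
  have him := hT.comp_hasFDerivAt z (imCLM.hasFDerivAt.comp z hΦR)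
  obtain ⟨h1, h2, h3, h4⟩ := charCoeffs_mul_real hp (hre.mul him) hp0 (mul_ne_zero hR0 hT0)
    (F := F) (G := G) (fun w => by rw [hF]; simp) (fun w => by rw [hG]; simp)
  have hR0' : (R (Φ z).re : ℂ) ≠ 0 := ofReal_ne_zero.2 hR0
  have hT0' : (T (Φ z).im : ℂ) ≠ 0 := ofReal_ne_zero.2 hT0
  have hPc : (starRingEnd ℂ) P = P.re - P.im * I := by
    apply Complex.ext <;> simp
  refine ⟨h1, h2, h3.trans ?_, h4.trans ?_⟩
  · congr 1
    rw [hPc]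
    simp
    field_simp
    ring_nf
    simp only [I_sq]
    ring
  · congr 1
    simp
    field_simp
    linear_combination (T (Φ z).im * R' - R (Φ z).re * T' * I : ℂ) * re_add_im P +
      (R (Φ z).re * T' * P.im : ℂ) * I_sq

/-- for `Φ` holomorphic with nonvanishing derivative and `S, T` `C¹`
nonvanishing real functions of `s = Re Φ`, `t = Im Φ`, the pairs
`F_m = Φ_z^m F`, `G_m = Φ_z^m G` (`m` even) and `F_m = Φ_z^m F/S²`, `G_m = Φ_z^m S² G`
(`m` odd), with `F = S(s)T(t)`, `G = i/(S(s)T(t))`, form a generating sequence: each pair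
satisfies `Im(conj F_m · G_m) > 0` and `(F_{m+1},G_{m+1})` is a successor of `(F_m,G_m)`. -/
theorem statement13 (Ω : Set ℂ) (hΩ : IsOpen Ω)
    (Φ : ℂ → ℂ) (hΦ : DifferentiableOn ℂ Φ Ω)
    (hΦ' : ∀ z ∈ Ω, deriv Φ z ≠ 0)
    (S T : ℝ → ℝ) (hS : ContDiff ℝ 1 S) (hT : ContDiff ℝ 1 T)
    (hSne : ∀ x : ℝ, S x ≠ 0) (hTne : ∀ x : ℝ, T x ≠ 0)
    (F G : ℤ → ℂ → ℂ)
    (hF : ∀ m : ℤ, ∀ z : ℂ,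
      F m z = if Even m then
          (deriv Φ z) ^ m * ((S (Φ z).re : ℂ) * (T (Φ z).im : ℂ))
        else
          (deriv Φ z) ^ m * ((S (Φ z).re : ℂ) * (T (Φ z).im : ℂ)) / ((S (Φ z).re : ℂ)) ^ 2)
    (hG : ∀ m : ℤ, ∀ z : ℂ,
      G m z = if Even m then
          (deriv Φ z) ^ m * (Complex.I / ((S (Φ z).re : ℂ) * (T (Φ z).im : ℂ)))
        else
          (deriv Φ z) ^ m * ((S (Φ z).re : ℂ)) ^ 2 *
            (Complex.I / ((S (Φ z).re : ℂ) * (T (Φ z).im : ℂ)))) :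
    ∀ m : ℤ, ∀ z ∈ Ω,
      0 < ((starRingEnd ℂ) (F m z) * G m z).im ∧
      charA (F (m + 1)) (G (m + 1)) z = charA (F m) (G m) z ∧
      charB (F (m + 1)) (G (m + 1)) z = -charBigB (F m) (G m) z := by
  intro m z hz
  have hd := (hΦ.differentiableAt (hΩ.mem_nhds hz)).hasDerivAt
  have hP0 := hΦ' z hz
  have hpow : ∀ k : ℤ, HasDerivAt (fun w => deriv Φ w ^ k)
      (deriv (fun w => deriv Φ w ^ k) z) z := fun k =>
    (((hΦ.deriv hΩ).differentiableAt (hΩ.mem_nhds hz)).zpow (Or.inl hP0)).hasDerivAt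
  have hSd := (hS.differentiable one_ne_zero (Φ z).re).hasDerivAt
  have hTd := (hT.differentiable one_ne_zero (Φ z).im).hasDerivAt
  have hSd' := hSd.fun_inv (hSne _)
  have hSC : ∀ x, (S x : ℂ) ≠ 0 := fun x => ofReal_ne_zero.2 (hSne x)
  have hTC : ∀ x, (T x : ℂ) ≠ 0 := fun x => ofReal_ne_zero.2 (hTne x)
  have hEven : ∀ k : ℤ, Even k → _ := fun k hk =>
    charCoeffs_mul_separated (F := F k) (G := G k) (hpow k) hd hSd hTd
      (zpow_ne_zero k hP0) (hSne _) (hTne _)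
      (fun w => by rw [hF, if_pos hk]) (fun w => by rw [hG, if_pos hk])
  have hOdd : ∀ k : ℤ, ¬ Even k → _ := fun k hk =>
    charCoeffs_mul_separated (F := F k) (G := G k) (hpow k) hd hSd' hTd
      (zpow_ne_zero k hP0) (inv_ne_zero (hSne _)) (hTne _)
      (fun w => by
        have := hSC (Φ w).re
        rw [hF, if_neg hk]; push_cast; field_simp)
      (fun w => by
        have := hSC (Φ w).re
        have := hTC (Φ w).im
        rw [hG, if_neg hk]; push_cast; field_simp)
  have hs := hSC (Φ z).re
  have ht := hTC (Φ z).im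
  have hPc : (starRingEnd ℂ) (deriv Φ z) ≠ 0 := (map_ne_zero _).2 hP0
  by_cases hm : Even m
  · obtain ⟨h1, h2, -, h4⟩ := hEven m hm
    obtain ⟨-, k2, k3, -⟩ := hOdd (m + 1) (by simpa [Int.even_add_one] using hm)
    refine ⟨h1, k2.trans h2.symm, ?_⟩
    rw [k3, h4, map_zpow₀, map_zpow₀, zpow_add_one₀ hP0, zpow_add_one₀ hPc]
    push_cast
    field_simp
    ring
  · obtain ⟨h1, h2, -, h4⟩ := hOdd m hm
    obtain ⟨-, k2, k3, -⟩ := hEven (m + 1) (by simpa [Int.even_add_one] using hm)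
    refine ⟨h1, k2.trans h2.symm, ?_⟩
    rw [k3, h4, map_zpow₀, map_zpow₀, zpow_add_one₀ hP0, zpow_add_one₀ hPc]
    push_cast
    field_simp
    ring
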